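/- Let n ≥ 3 and u : ℝⁿ → ℝ be C² and positive. For x ∈ ℝⁿ and λ > 0, let u_{x,λ}(y) = (λ/|y−x|)^{n−2} u(x + λ²(y−x)/|y−x|²). Then for every y ≠ x, A^{u_{x,λ}}(y) = O(y)ᵀ A^u(x + λ²(y−x)/|y−x|²) O(y), where O(y) = I − 2 (y−x)(y−x)ᵀ/|y−x|² is the reflection matrix. In particular, if F is O(n)-invariant, then F(A^{u_{x,λ}}(y)) = F(A^u(x + λ²(y−x)/|y−x|²)); consequently if u satisfies F(A^u) = u^{p−(n+2)/(n−2)} on ℝⁿ, then F(A^{u_{x,λ}}(y)) = (λ/|y−x|)^{(n−2)((n+2)/(n−2)−p)} u_{x,λ}(y)^{p−(n+2)/(n−2)} for all y ≠ x. -/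

import Mathlib

open Filter Metric Matrix

/-- Gradient of `u` as a vector of partial derivatives. -/
noncomputable def gradv {n : ℕ} (u : EuclideanSpace ℝ (Fin n) → ℝ)
    (x : EuclideanSpace ℝ (Fin n)) : Fin n → ℝ :=
  fun i => fderiv ℝ u x (EuclideanSpace.single i 1)

/-- Hessian matrix of `u`. -/
noncomputable def hess {n : ℕ} (u : EuclideanSpace ℝ (Fin n) → ℝ)
    (x : EuclideanSpace ℝ (Fin n)) : Matrix (Fin n) (Fin n) ℝ :=
  Matrix.of fun i j =>
    fderiv ℝ (fun z => fderiv ℝ u z (EuclideanSpace.single j 1)) x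
      (EuclideanSpace.single i 1)

/-- The conformal Schouten-type tensor
`A^u = -(2/(n-2)) u^{-(n+2)/(n-2)} ∇²u + (2n/(n-2)²) u^{-2n/(n-2)} ∇u⊗∇u
 - (2/(n-2)²) u^{-2n/(n-2)} |∇u|² I`. -/
noncomputable def Amat {n : ℕ} (u : EuclideanSpace ℝ (Fin n) → ℝ)
    (x : EuclideanSpace ℝ (Fin n)) : Matrix (Fin n) (Fin n) ℝ :=
  (-(2 / ((n : ℝ) - 2)) * u x ^ (-(((n : ℝ) + 2) / ((n : ℝ) - 2)))) • hess u x
    + ((2 * (n : ℝ) / ((n : ℝ) - 2) ^ 2) * u x ^ (-(2 * (n : ℝ) / ((n : ℝ) - 2)))) •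
        Matrix.vecMulVec (gradv u x) (gradv u x)
    - ((2 / ((n : ℝ) - 2) ^ 2) * u x ^ (-(2 * (n : ℝ) / ((n : ℝ) - 2))) *
        (∑ i, gradv u x i ^ 2)) • (1 : Matrix (Fin n) (Fin n) ℝ)

section Kelvin

variable {n : ℕ}

theorem fderiv_apply_eq_of_hasDerivAt_line {E : Type*} [NormedAddCommGroup E] [NormedSpace ℝ E]
    {f : E → ℝ} {y e : E} {d : ℝ} (hf : DifferentiableAt ℝ f y)
    (h : HasDerivAt (fun t : ℝ => f (y + t • e)) d 0) : fderiv ℝ f y e = d :=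
  (hf.hasFDerivAt.hasLineDerivAt e).unique h

/-- The tensor `v ∇²v - ½ |∇v|² I`, which equals `A^u` for `v = u ^ (-2 / (n - 2))`. -/
noncomputable def schoutenMat (v : EuclideanSpace ℝ (Fin n) → ℝ) (x : EuclideanSpace ℝ (Fin n)) :
    Matrix (Fin n) (Fin n) ℝ :=
  v x • hess v x - ((∑ i, gradv v x i ^ 2) / 2) • (1 : Matrix (Fin n) (Fin n) ℝ)

theorem gradv_rpow {u : EuclideanSpace ℝ (Fin n) → ℝ} {y : EuclideanSpace ℝ (Fin n)}
    (hu : DifferentiableAt ℝ u y) (hpos : 0 < u y) (a : ℝ) (i : Fin n) :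
    gradv (fun z => u z ^ a) y i = a * u y ^ (a - 1) * gradv u y i := by
  simp only [gradv]
  rw [(hu.hasFDerivAt.rpow_const (Or.inl hpos.ne')).fderiv]
  simp

theorem differentiableAt_gradv {u : EuclideanSpace ℝ (Fin n) → ℝ} {y : EuclideanSpace ℝ (Fin n)}
    (hu : ContDiffAt ℝ 2 u y) (i : Fin n) : DifferentiableAt ℝ (fun z => gradv u z i) y := by
  have h : DifferentiableAt ℝ (fderiv ℝ u) y :=
    (hu.fderiv_right (m := 1) (by norm_num)).differentiableAt (by norm_num)
  exact h.clm_apply (differentiableAt_const _)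

theorem hess_apply (u : EuclideanSpace ℝ (Fin n) → ℝ) (y : EuclideanSpace ℝ (Fin n))
    (i j : Fin n) : hess u y i j = gradv (fun z => gradv u z j) y i := rfl

theorem schoutenMat_congr {v w : EuclideanSpace ℝ (Fin n) → ℝ} {y : EuclideanSpace ℝ (Fin n)}
    (h : v =ᶠ[nhds y] w) : schoutenMat v y = schoutenMat w y := by
  have hg (j : Fin n) : (fun z => gradv v z j) =ᶠ[nhds y] fun z => gradv w z j :=
    (h.fderiv (𝕜 := ℝ)).mono fun z hz => by simp only [gradv, hz]
  have hh : hess v y = hess w y := by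
    ext i j
    rw [hess_apply, hess_apply]
    exact congrArg (fun L : EuclideanSpace ℝ (Fin n) →L[ℝ] ℝ => L (EuclideanSpace.single i 1))
      (hg j).fderiv_eq
  simp only [schoutenMat, hh, h.eq_of_nhds, fun j => (hg j).eq_of_nhds]

theorem hess_rpow {u : EuclideanSpace ℝ (Fin n) → ℝ} {y : EuclideanSpace ℝ (Fin n)}
    (hu : ContDiffAt ℝ 2 u y) (hpos : 0 < u y) (a : ℝ) (i j : Fin n) :
    hess (fun z => u z ^ a) y i j =
      a * (a - 1) * u y ^ (a - 2) * (gradv u y i * gradv u y j) +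
        a * u y ^ (a - 1) * hess u y i j := by
  have hev : (fun z => gradv (fun z => u z ^ a) z j) =ᶠ[nhds y]
      fun z => a * u z ^ (a - 1) * gradv u z j := by
    filter_upwards [hu.continuousAt.eventually (lt_mem_nhds hpos),
      hu.eventually (by simp)] with z hz hz'
    exact gradv_rpow (hz'.differentiableAt (by norm_num)) hz a j
  have hd := hu.differentiableAt (by norm_num)
  have h1 := (hd.hasFDerivAt.rpow_const (p := a - 1) (Or.inl hpos.ne')).const_mul a
  have h2 := h1.mul (differentiableAt_gradv hu j).hasFDerivAt
  rw [hess_apply, hess_apply]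
  unfold gradv at hev h2 ⊢
  rw [hev.fderiv_eq]
  erw [h2.fderiv]
  simp [show a - 1 - 1 = a - 2 by ring]
  ring

theorem Amat_eq_schoutenMat (hn : 3 ≤ n) {u : EuclideanSpace ℝ (Fin n) → ℝ}
    {y : EuclideanSpace ℝ (Fin n)} (hu : ContDiffAt ℝ 2 u y) (hpos : 0 < u y) :
    Amat u y = schoutenMat (fun z => u z ^ (-(2 / ((n : ℝ) - 2)))) y := by
  have hn' : (n : ℝ) - 2 ≠ 0 := by
    have : (3 : ℝ) ≤ n := by exact_mod_cast hn
    linarith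
  set a : ℝ := -(2 / ((n : ℝ) - 2)) with ha
  have e1 : -(((n : ℝ) + 2) / ((n : ℝ) - 2)) = a + (a - 1) := by rw [ha]; field_simp; ring
  have e2 : -(2 * (n : ℝ) / ((n : ℝ) - 2)) = a + (a - 2) := by rw [ha]; field_simp; ring
  have e3 : 2 * (n : ℝ) / ((n : ℝ) - 2) ^ 2 = a * (a - 1) := by rw [ha]; field_simp; ring
  have e4 : 2 / ((n : ℝ) - 2) ^ 2 = a ^ 2 / 2 := by rw [ha]; field_simp
  have e5 : u y ^ a * u y ^ (a - 2) = (u y ^ (a - 1)) ^ 2 := by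
    rw [← Real.rpow_add hpos, sq, ← Real.rpow_add hpos]; ring_nf
  have hd := hu.differentiableAt (by norm_num)
  ext i j
  simp only [Amat, schoutenMat, e1, e2, e3, e4, Matrix.sub_apply, Matrix.add_apply,
    Matrix.smul_apply, smul_eq_mul, hess_rpow hu hpos, gradv_rpow hd hpos, mul_pow,
    ← Finset.mul_sum, Matrix.vecMulVec_apply, Real.rpow_add hpos a]
  linear_combination (-(a ^ 2 / 2) * (∑ i, gradv u y i ^ 2) * (1 : Matrix _ _ ℝ) i j) * e5

section Inversion

variable {x y : EuclideanSpace ℝ (Fin n)} {l : ℝ}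

theorem fderiv_apply_eq_sum_gradv (f : EuclideanSpace ℝ (Fin n) → ℝ)
    (z w : EuclideanSpace ℝ (Fin n)) : fderiv ℝ f z w = ∑ k, w k * gradv f z k := by
  conv_lhs => rw [← (EuclideanSpace.basisFun (Fin n) ℝ).sum_repr w]
  simp [gradv]

theorem hasDerivAt_normSq_line (i : Fin n) :
    HasDerivAt (fun t : ℝ => ‖y + t • EuclideanSpace.single i (1 : ℝ) - x‖ ^ 2)
      (2 * (y - x) i) 0 := by
  have h : HasDerivAt (fun t : ℝ => y + t • EuclideanSpace.single i (1 : ℝ) - x)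
      (EuclideanSpace.single i (1 : ℝ)) 0 := by
    simpa using (((hasDerivAt_id (0 : ℝ)).smul_const
      (EuclideanSpace.single i (1 : ℝ))).const_add y).sub_const x
  exact h.norm_sq.congr_deriv (by simp [EuclideanSpace.inner_single_right])

theorem hasDerivAt_coord_line (i k : Fin n) :
    HasDerivAt (fun t : ℝ => (y + t • EuclideanSpace.single i (1 : ℝ) - x) k)
      ((1 : Matrix (Fin n) (Fin n) ℝ) i k) 0 := by
  have := (((hasDerivAt_id (0 : ℝ)).mul_const
      ((1 : Matrix (Fin n) (Fin n) ℝ) i k)).const_add (y k)).sub_const (x k)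
  simpa [Matrix.one_apply, Pi.single_apply, eq_comm] using this

theorem contDiff_normSq_sub (x : EuclideanSpace ℝ (Fin n)) :
    ContDiff ℝ 2 fun z => ‖z - x‖ ^ 2 :=
  (contDiff_id.sub contDiff_const).norm_sq ℝ

theorem differentiableAt_inversion (hy : y ≠ x) :
    DifferentiableAt ℝ (fun z => x + (l ^ 2 / ‖z - x‖ ^ 2) • (z - x)) y := by
  have : ‖y - x‖ ^ 2 ≠ 0 := by simpa [sub_eq_zero] using hy
  have h : DifferentiableAt ℝ (fun z => ‖z - x‖ ^ 2) y :=
      (contDiff_normSq_sub x).differentiable (by norm_num) y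
  fun_prop (disch := assumption)

theorem contDiffAt_inversion (hy : y ≠ x) :
    ContDiffAt ℝ 2 (fun z => x + (l ^ 2 / ‖z - x‖ ^ 2) • (z - x)) y := by
  have : ‖y - x‖ ^ 2 ≠ 0 := by simpa [sub_eq_zero] using hy
  have h : ContDiffAt ℝ 2 (fun z => ‖z - x‖ ^ 2) y :=
      (contDiff_normSq_sub x).contDiffAt
  fun_prop (disch := assumption)

theorem hasDerivAt_comp_inversion_line (hy : y ≠ x) {f : EuclideanSpace ℝ (Fin n) → ℝ}
    (hf : DifferentiableAt ℝ f (x + (l ^ 2 / ‖y - x‖ ^ 2) • (y - x))) (i : Fin n) :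
    HasDerivAt (fun t : ℝ => f (x +
        (l ^ 2 / ‖y + t • EuclideanSpace.single i (1 : ℝ) - x‖ ^ 2) •
          (y + t • EuclideanSpace.single i (1 : ℝ) - x)))
      (l ^ 2 / ‖y - x‖ ^ 2 * (gradv f (x + (l ^ 2 / ‖y - x‖ ^ 2) • (y - x)) i -
        2 * (y - x) i / ‖y - x‖ ^ 2 *
          ∑ k, (y - x) k * gradv f (x + (l ^ 2 / ‖y - x‖ ^ 2) • (y - x)) k)) 0 := by
  have hr : ‖y - x‖ ≠ 0 := by simpa [sub_eq_zero] using hy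
  have h : HasDerivAt (fun t : ℝ => y + t • EuclideanSpace.single i (1 : ℝ) - x)
      (EuclideanSpace.single i (1 : ℝ)) 0 := by
    simpa using (((hasDerivAt_id (0 : ℝ)).smul_const
      (EuclideanSpace.single i (1 : ℝ))).const_add y).sub_const x
  have hN := (hasDerivAt_const (0 : ℝ) (l ^ 2)).fun_div
    (hasDerivAt_normSq_line (x := x) (y := y) i) (by simpa using hr)
  have hφ := (hN.fun_smul h).const_add x
  have hf' : HasFDerivAt f (fderiv ℝ f (x + (l ^ 2 / ‖y - x‖ ^ 2) • (y - x)))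
      (x + (l ^ 2 / ‖y + (0 : ℝ) • EuclideanSpace.single i (1 : ℝ) - x‖ ^ 2) •
          (y + (0 : ℝ) • EuclideanSpace.single i (1 : ℝ) - x)) := by
    simpa using hf.hasFDerivAt
  refine (hf'.comp_hasDerivAt (0 : ℝ) hφ).congr_deriv ?_
  simp only [zero_smul, add_zero, map_add, map_smul, smul_eq_mul, ← fderiv_apply_eq_sum_gradv]
  simp only [gradv]
  field_simp
  ring

/-- The function `z ↦ (|z - x|² / l²) v(x + l² (z - x) / |z - x|²)`: if `v = u ^ (-2 / (n - 2))`,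
it equals `u_{x,l} ^ (-2 / (n - 2))`. -/
noncomputable def kelvin (v : EuclideanSpace ℝ (Fin n) → ℝ) (x : EuclideanSpace ℝ (Fin n)) (l : ℝ)
    (z : EuclideanSpace ℝ (Fin n)) : ℝ :=
  ‖z - x‖ ^ 2 / l ^ 2 * v (x + (l ^ 2 / ‖z - x‖ ^ 2) • (z - x))

theorem gradv_kelvin {v : EuclideanSpace ℝ (Fin n) → ℝ} (hv : ContDiff ℝ 2 v) (hl : l ≠ 0)
    (hy : y ≠ x) (i : Fin n) :
    gradv (kelvin v x l) y i =
      2 * (y - x) i / l ^ 2 * v (x + (l ^ 2 / ‖y - x‖ ^ 2) • (y - x)) +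
      (gradv v (x + (l ^ 2 / ‖y - x‖ ^ 2) • (y - x)) i - 2 * (y - x) i / ‖y - x‖ ^ 2 *
        ∑ k, (y - x) k * gradv v (x + (l ^ 2 / ‖y - x‖ ^ 2) • (y - x)) k) := by
  have hr : ‖y - x‖ ≠ 0 := by simpa [sub_eq_zero] using hy
  have hvd : Differentiable ℝ v := hv.differentiable (by norm_num)
  have hd : DifferentiableAt ℝ (kelvin v x l) y := by
    have h := differentiableAt_inversion (l := l) hy
    have h' : DifferentiableAt ℝ (fun z => ‖z - x‖ ^ 2) y :=
      (contDiff_normSq_sub x).differentiable (by norm_num) y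
    unfold kelvin
    exact (h'.mul_const (l ^ 2)⁻¹).mul (hvd.differentiableAt.comp y h)
  refine fderiv_apply_eq_of_hasDerivAt_line hd ((((hasDerivAt_normSq_line i).div_const _).fun_mul
    (hasDerivAt_comp_inversion_line hy hvd.differentiableAt i)).congr_deriv ?_)
  simp only [zero_smul, add_zero]
  field_simp

theorem hess_kelvin {v : EuclideanSpace ℝ (Fin n) → ℝ} (hv : ContDiff ℝ 2 v) (hl : l ≠ 0)
    (hy : y ≠ x) (i j : Fin n) {ξ : EuclideanSpace ℝ (Fin n)}
    (hξ : x + (l ^ 2 / ‖y - x‖ ^ 2) • (y - x) = ξ) :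
    hess (kelvin v x l) y i j =
      (2 * v ξ / l ^ 2 - 2 / ‖y - x‖ ^ 2 * ∑ k, (y - x) k * gradv v ξ k) *
        (1 : Matrix (Fin n) (Fin n) ℝ) i j +
      l ^ 2 / ‖y - x‖ ^ 2 * (hess v ξ i j
        - 2 / ‖y - x‖ ^ 2 * ((y - x) i * ∑ k, (y - x) k * hess v ξ k j)
        - 2 / ‖y - x‖ ^ 2 * ((∑ k, hess v ξ i k * (y - x) k) * (y - x) j)
        + (2 / ‖y - x‖ ^ 2) ^ 2 * ((y - x) i *
          (∑ k, (y - x) k * ∑ m, hess v ξ k m * (y - x) m) * (y - x) j)) := by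
  have hr : ‖y - x‖ ≠ 0 := by simpa [sub_eq_zero] using hy
  have hvd : Differentiable ℝ v := hv.differentiable (by norm_num)
  have hgd (k : Fin n) : Differentiable ℝ fun z => gradv v z k :=
    fun z => differentiableAt_gradv hv.contDiffAt k
  have hev : (fun z => gradv (kelvin v x l) z j) =ᶠ[nhds y] fun z =>
      2 * (z - x) j / l ^ 2 * v (x + (l ^ 2 / ‖z - x‖ ^ 2) • (z - x)) +
      (gradv v (x + (l ^ 2 / ‖z - x‖ ^ 2) • (z - x)) j - 2 * (z - x) j / ‖z - x‖ ^ 2 *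
        ∑ k, (z - x) k * gradv v (x + (l ^ 2 / ‖z - x‖ ^ 2) • (z - x)) k) := by
    filter_upwards [isOpen_ne.mem_nhds hy] with z hz
    exact gradv_kelvin hv hl hz j
  have hcd : ContDiffAt ℝ 2 (kelvin v x l) y := by
    have h := contDiffAt_inversion (l := l) hy
    have h' : ContDiffAt ℝ 2 (fun z => ‖z - x‖ ^ 2) y :=
      (contDiff_normSq_sub x).contDiffAt
    unfold kelvin
    exact (h'.div_const _).mul (hv.contDiffAt.comp y h)
  have hd := hev.differentiableAt_iff.1 (differentiableAt_gradv hcd j)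
  rw [hess_apply, gradv, hev.fderiv_eq]
  have hc (k : Fin n) := hasDerivAt_coord_line (x := x) (y := y) i k
  have hsum := HasDerivAt.fun_sum (u := Finset.univ) fun k (_ : k ∈ Finset.univ) =>
    (hc k).fun_mul (hasDerivAt_comp_inversion_line (l := l) hy (hgd k).differentiableAt i)
  have hq := ((hc j).const_mul 2).fun_div (hasDerivAt_normSq_line (x := x) (y := y) i)
    (by simpa using hr)
  have htot := ((((hc j).const_mul 2).div_const (l ^ 2)).fun_mul
    (hasDerivAt_comp_inversion_line (l := l) hy hvd.differentiableAt i)).fun_add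
    ((hasDerivAt_comp_inversion_line (l := l) hy (hgd j).differentiableAt i).fun_sub
      (hq.fun_mul hsum))
  refine fderiv_apply_eq_of_hasDerivAt_line hd (htot.congr_deriv ?_)
  simp only [zero_smul, add_zero, hξ, ← hess_apply]
  have hs1 : ∑ k, ((1 : Matrix (Fin n) (Fin n) ℝ) i k * gradv v ξ k) = gradv v ξ i := by
    simp [Matrix.one_apply]
  have hs2 : ∑ k, (y - x) k * ∑ m, (y - x) m * hess v ξ m k =
      ∑ k, (y - x) k * ∑ m, hess v ξ k m * (y - x) m := by
    simp only [Finset.mul_sum]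
    rw [Finset.sum_comm]
    exact Finset.sum_congr rfl fun _ _ => Finset.sum_congr rfl fun _ _ => by ring
  have hs3 : ∑ k, ((1 : Matrix (Fin n) (Fin n) ℝ) i k * gradv v ξ k +
      (y - x) k * (l ^ 2 / ‖y - x‖ ^ 2 * (hess v ξ i k -
        2 * (y - x) i / ‖y - x‖ ^ 2 * ∑ m, (y - x) m * hess v ξ m k))) =
      gradv v ξ i + l ^ 2 / ‖y - x‖ ^ 2 * ((∑ k, hess v ξ i k * (y - x) k) -
        2 * (y - x) i / ‖y - x‖ ^ 2 * ∑ k, (y - x) k * ∑ m, hess v ξ k m * (y - x) m) := by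
    rw [Finset.sum_add_distrib, hs1, ← hs2, Finset.mul_sum (a := 2 * (y - x) i / ‖y - x‖ ^ 2),
      ← Finset.sum_sub_distrib, Finset.mul_sum]
    congr 1
    exact Finset.sum_congr rfl fun _ _ => by ring
  rw [hs3]
  field_simp
  ring

theorem sum_gradv_kelvin_sq {v : EuclideanSpace ℝ (Fin n) → ℝ} (hv : ContDiff ℝ 2 v) (hl : l ≠ 0)
    (hy : y ≠ x) {ξ : EuclideanSpace ℝ (Fin n)}
    (hξ : x + (l ^ 2 / ‖y - x‖ ^ 2) • (y - x) = ξ) :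
    ∑ i, gradv (kelvin v x l) y i ^ 2 =
      4 * ‖y - x‖ ^ 2 / l ^ 4 * v ξ ^ 2 - 4 * v ξ / l ^ 2 * (∑ k, (y - x) k * gradv v ξ k) +
        ∑ k, gradv v ξ k ^ 2 := by
  have hr : ‖y - x‖ ≠ 0 := by simpa [sub_eq_zero] using hy
  simp only [gradv_kelvin hv hl hy, hξ]
  set S := ∑ k, (y - x) k * gradv v ξ k with hS
  set c := 2 / l ^ 2 * v ξ - 2 / ‖y - x‖ ^ 2 * S with hc
  have h : ∀ i, (2 * (y - x) i / l ^ 2 * v ξ +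
      (gradv v ξ i - 2 * (y - x) i / ‖y - x‖ ^ 2 * S)) ^ 2 =
      c ^ 2 * (y - x) i ^ 2 + 2 * c * ((y - x) i * gradv v ξ i) + gradv v ξ i ^ 2 := by
    intro i; rw [hc]; ring
  simp only [h, Finset.sum_add_distrib, ← Finset.mul_sum]
  rw [← hS, ← EuclideanSpace.real_norm_sq_eq, hc]
  field_simp
  ring

theorem reflection_mul_self (hy : y ≠ x) :
    ((1 : Matrix (Fin n) (Fin n) ℝ) - (2 / ‖y - x‖ ^ 2) •
      Matrix.vecMulVec (fun i => (y - x) i) (fun i => (y - x) i)) *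
    ((1 : Matrix (Fin n) (Fin n) ℝ) - (2 / ‖y - x‖ ^ 2) •
      Matrix.vecMulVec (fun i => (y - x) i) (fun i => (y - x) i)) = 1 := by
  have hr : ‖y - x‖ ≠ 0 := by simpa [sub_eq_zero] using hy
  have hw : (fun i => (y - x) i) ⬝ᵥ (fun i => (y - x) i) = ‖y - x‖ ^ 2 := by
    rw [EuclideanSpace.real_norm_sq_eq]
    exact Finset.sum_congr rfl fun _ _ => by ring
  rw [sub_mul, mul_sub, mul_sub, smul_mul_smul_comm, Matrix.vecMulVec_mul_vecMulVec, hw]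
  ext i j
  simp only [Matrix.sub_apply, Matrix.smul_apply, Matrix.vecMulVec_apply, Matrix.one_mul,
    Matrix.mul_one, smul_eq_mul, Pi.smul_apply]
  field_simp
  ring

theorem reflection_transpose :
    ((1 : Matrix (Fin n) (Fin n) ℝ) - (2 / ‖y - x‖ ^ 2) •
      Matrix.vecMulVec (fun i => (y - x) i) (fun i => (y - x) i))ᵀ =
    (1 : Matrix (Fin n) (Fin n) ℝ) - (2 / ‖y - x‖ ^ 2) •
      Matrix.vecMulVec (fun i => (y - x) i) (fun i => (y - x) i) := by
  simp [Matrix.transpose_sub, Matrix.transpose_smul, Matrix.transpose_vecMulVec]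

theorem one_sub_smul_vecMulVec_conj_apply (s : ℝ) (w : Fin n → ℝ) (H : Matrix (Fin n) (Fin n) ℝ)
    (i j : Fin n) :
    ((1 - s • Matrix.vecMulVec w w) * H * (1 - s • Matrix.vecMulVec w w)) i j =
      H i j - s * (w i * ∑ k, w k * H k j) - s * ((∑ k, H i k * w k) * w j) +
        s ^ 2 * (w i * (∑ k, w k * ∑ m, H k m * w m) * w j) := by
  have : (1 - s • Matrix.vecMulVec w w) * H * (1 - s • Matrix.vecMulVec w w) =
      H - s • Matrix.vecMulVec w (w ᵥ* H) - s • Matrix.vecMulVec (H *ᵥ w) w +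
        (s ^ 2 * (w ⬝ᵥ H *ᵥ w)) • Matrix.vecMulVec w w := by
    simp only [sub_mul, mul_sub, Matrix.one_mul, Matrix.mul_one, smul_mul_assoc, mul_smul_comm,
      Matrix.mul_vecMulVec, Matrix.vecMulVec_mul, Matrix.vecMulVec_mulVec,
      Matrix.dotProduct_mulVec]
    ext i j
    simp [Matrix.vecMulVec_apply]
    ring
  rw [this]
  simp [Matrix.vecMulVec_apply, Matrix.vecMul, Matrix.mulVec, dotProduct]
  ring

theorem conj_smul_sub_smul_one {O : Matrix (Fin n) (Fin n) ℝ} (hO : O * O = 1)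
    (H : Matrix (Fin n) (Fin n) ℝ) (a b : ℝ) :
    O * (a • H - b • (1 : Matrix (Fin n) (Fin n) ℝ)) * O = a • (O * H * O) - b • 1 := by
  simp only [mul_sub, sub_mul, mul_smul_comm, smul_mul_assoc, Matrix.mul_one, hO]

theorem schoutenMat_kelvin {v : EuclideanSpace ℝ (Fin n) → ℝ} (hv : ContDiff ℝ 2 v) (hl : l ≠ 0)
    (hy : y ≠ x) :
    schoutenMat (kelvin v x l) y =
      ((1 : Matrix (Fin n) (Fin n) ℝ) - (2 / ‖y - x‖ ^ 2) •
        Matrix.vecMulVec (fun i => (y - x) i) (fun i => (y - x) i)) *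
      schoutenMat v (x + (l ^ 2 / ‖y - x‖ ^ 2) • (y - x)) *
      ((1 : Matrix (Fin n) (Fin n) ℝ) - (2 / ‖y - x‖ ^ 2) •
        Matrix.vecMulVec (fun i => (y - x) i) (fun i => (y - x) i)) := by
  have hr : ‖y - x‖ ≠ 0 := by simpa [sub_eq_zero] using hy
  obtain ⟨ξ, hξ⟩ : ∃ ξ, x + (l ^ 2 / ‖y - x‖ ^ 2) • (y - x) = ξ := ⟨_, rfl⟩
  have hk : kelvin v x l y = ‖y - x‖ ^ 2 / l ^ 2 * v ξ := by rw [kelvin, hξ]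
  rw [hξ, schoutenMat, schoutenMat, conj_smul_sub_smul_one (reflection_mul_self hy),
    sum_gradv_kelvin_sq hv hl hy hξ, hk]
  ext i j
  simp only [Matrix.sub_apply, Matrix.smul_apply, smul_eq_mul, hess_kelvin hv hl hy i j hξ,
    one_sub_smul_vecMulVec_conj_apply]
  field_simp
  ring

end Inversion

end Kelvin

/-- Conformal transformation law for `A^u` under the Kelvin transform: with
`u_{x,λ}(y) = (λ/|y-x|)^{n-2} u(x + λ²(y-x)/|y-x|²)`, one has
`A^{u_{x,λ}}(y) = O(y)ᵀ A^u(ξ(y)) O(y)` where `ξ(y) = x + λ²(y-x)/|y-x|²` and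
`O(y) = I - 2(y-x)(y-x)ᵀ/|y-x|²`; hence `F(A^{u_{x,λ}}(y)) = F(A^u(ξ(y)))` for
`O(n)`-invariant `F`, and if `F(A^u) = u^{p-(n+2)/(n-2)}` then
`F(A^{u_{x,λ}}(y)) = (λ/|y-x|)^{(n-2)((n+2)/(n-2)-p)} u_{x,λ}(y)^{p-(n+2)/(n-2)}`. -/
theorem stmt11 {n : ℕ} (hn : 3 ≤ n)
    (u : EuclideanSpace ℝ (Fin n) → ℝ) (hu : ContDiff ℝ 2 u) (hpos : ∀ x, 0 < u x)
    (x : EuclideanSpace ℝ (Fin n)) (l : ℝ) (hl : 0 < l)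
    (uxl : EuclideanSpace ℝ (Fin n) → ℝ)
    (huxl : ∀ y, uxl y =
      (l / ‖y - x‖) ^ (n - 2) * u (x + (l ^ 2 / ‖y - x‖ ^ 2) • (y - x)))
    (F : Matrix (Fin n) (Fin n) ℝ → ℝ)
    (hFinv : ∀ O M : Matrix (Fin n) (Fin n) ℝ, Oᵀ * O = 1 → F (O⁻¹ * M * O) = F M)
    (p : ℝ)
    (hEq : ∀ z, F (Amat u z) = u z ^ (p - ((n : ℝ) + 2) / ((n : ℝ) - 2))) :
    ∀ y : EuclideanSpace ℝ (Fin n), y ≠ x →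
      Amat uxl y =
        ((1 : Matrix (Fin n) (Fin n) ℝ)
            - (2 / ‖y - x‖ ^ 2) • Matrix.vecMulVec (fun i => (y - x) i) (fun i => (y - x) i))ᵀ
          * Amat u (x + (l ^ 2 / ‖y - x‖ ^ 2) • (y - x))
          * ((1 : Matrix (Fin n) (Fin n) ℝ)
            - (2 / ‖y - x‖ ^ 2) • Matrix.vecMulVec (fun i => (y - x) i) (fun i => (y - x) i)) ∧
      F (Amat uxl y) = F (Amat u (x + (l ^ 2 / ‖y - x‖ ^ 2) • (y - x))) ∧
      F (Amat uxl y) =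
        (l / ‖y - x‖) ^ (((n : ℝ) - 2) * (((n : ℝ) + 2) / ((n : ℝ) - 2) - p)) *
          uxl y ^ (p - ((n : ℝ) + 2) / ((n : ℝ) - 2)) := by
  intro y hy
  have hr : 0 < ‖y - x‖ := by simpa [sub_eq_zero] using hy
  have hnR : (3 : ℝ) ≤ n := by exact_mod_cast hn
  have hn2 : (n : ℝ) - 2 ≠ 0 := by linarith
  have hcast : ((n - 2 : ℕ) : ℝ) = (n : ℝ) - 2 := by
    rw [Nat.cast_sub (by omega)]; norm_num
  have hA : Amat uxl y =
      ((1 : Matrix (Fin n) (Fin n) ℝ)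
          - (2 / ‖y - x‖ ^ 2) • Matrix.vecMulVec (fun i => (y - x) i) (fun i => (y - x) i))ᵀ
        * Amat u (x + (l ^ 2 / ‖y - x‖ ^ 2) • (y - x))
        * ((1 : Matrix (Fin n) (Fin n) ℝ)
          - (2 / ‖y - x‖ ^ 2) • Matrix.vecMulVec (fun i => (y - x) i) (fun i => (y - x) i)) := by
    have hposy : 0 < uxl y := by rw [huxl]; exact mul_pos (by positivity) (hpos _)
    have hcd : ContDiffAt ℝ 2 uxl y := by
      have h := contDiffAt_inversion (l := l) hy
      have hne : ‖y - x‖ ≠ 0 := hr.ne'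
      have hne' : y - x ≠ 0 := sub_ne_zero.2 hy
      have h' : ContDiffAt ℝ 2 (fun z => (l / ‖z - x‖) ^ (n - 2)) y :=
        (contDiffAt_const.div ((contDiffAt_id.sub contDiffAt_const).norm ℝ hne') hne).pow _
      rw [funext huxl]
      exact h'.mul (hu.contDiffAt.comp y h)
    have hv : ContDiff ℝ 2 fun z => u z ^ (-(2 / ((n : ℝ) - 2))) :=
      hu.rpow_const_of_ne fun z => (hpos z).ne'
    have hkel : (fun z => uxl z ^ (-(2 / ((n : ℝ) - 2)))) =ᶠ[nhds y]
        kelvin (fun z => u z ^ (-(2 / ((n : ℝ) - 2)))) x l := by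
      filter_upwards [isOpen_ne.mem_nhds hy] with z hz
      have hz' : 0 < ‖z - x‖ := by simpa [sub_eq_zero] using hz
      have hq : 0 < l / ‖z - x‖ := by positivity
      rw [huxl, kelvin, Real.mul_rpow (by positivity) (hpos _).le, ← Real.rpow_natCast _ (n - 2),
        ← Real.rpow_mul hq.le, hcast,
        show ((n : ℝ) - 2) * (-(2 / ((n : ℝ) - 2))) = -(2 : ℕ) by field_simp; norm_num,
        Real.rpow_neg hq.le, Real.rpow_natCast, div_pow, inv_div]
    rw [Amat_eq_schoutenMat hn hcd hposy, Amat_eq_schoutenMat hn hu.contDiffAt (hpos _),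
      schoutenMat_congr hkel, reflection_transpose, schoutenMat_kelvin hv hl.ne' hy]
  have hO := reflection_mul_self hy
  have hF : F (Amat uxl y) = F (Amat u (x + (l ^ 2 / ‖y - x‖ ^ 2) • (y - x))) := by
    rw [hA, reflection_transpose]
    have h := hFinv _ (Amat u (x + (l ^ 2 / ‖y - x‖ ^ 2) • (y - x)))
      ((congrArg (· * _) reflection_transpose).trans hO)
    rwa [Matrix.inv_eq_right_inv hO] at h
  refine ⟨hA, hF, ?_⟩
  have hq : 0 < l / ‖y - x‖ := by positivity
  rw [hF, hEq, huxl, Real.mul_rpow (by positivity) (hpos _).le, ← Real.rpow_natCast _ (n - 2),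
    ← Real.rpow_mul hq.le, hcast, ← mul_assoc, ← Real.rpow_add hq,
    show ((n : ℝ) - 2) * (((n : ℝ) + 2) / ((n : ℝ) - 2) - p) +
      ((n : ℝ) - 2) * (p - ((n : ℝ) + 2) / ((n : ℝ) - 2)) = 0 by ring,
    Real.rpow_zero, one_mul]
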